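/- arXiv:1812.05047 — 3 statements merged into one kernel-verified Lean document; each statement's English description precedes it below -/
import Mathlib

section
/- Let v₁, v₂ be two vertexes of Γ joined by the edge e₁,₂, and suppose there exists at least one N-partition of Γ in which v₁ and v₂ belong to the same subgraph. Then for every fixed λ ∈ (0,1] there exists a constant c > 0 such that, for every edge weight g' which agrees with g on all edges except e₁,₂ and satisfies g'(e₁,₂) > c, every N-partition minimizing F_λ (computed with weights f and g') places v₁ and v₂ in the same subgraph. -/
open Finset

namespace Districting

variable {V : Type*} [Fintype V] [DecidableEq V]

/-- An `N`-partition of a graph `G`: a family of `N` pairwise disjoint sets of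
vertexes covering all of `V`, each inducing a connected subgraph of `G`. -/
structure Partition (G : SimpleGraph V) (N : ℕ) where
  part : Fin N → Finset V
  disj : ∀ k l, k ≠ l → Disjoint (part k) (part l)
  covers : ∀ v : V, ∃ k, v ∈ part k
  connected : ∀ k, (G.induce (part k : Set V)).Connected

/-- The mass of a set of vertexes w.r.t. the vertex weight `f`. -/
def mass (f : V → ℝ) (s : Finset V) : ℝ := ∑ v ∈ s, f v

/-- The total mass of the graph w.r.t. the vertex weight `f`. -/
def totalMass (f : V → ℝ) : ℝ := ∑ v : V, f v

open Classical in
/-- The cut (perimeter) energy of a partition: the sum of the weights of edges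
whose endpoints lie in different parts. -/
noncomputable def cutEnergy (G : SimpleGraph V) (g : Sym2 V → ℝ) {N : ℕ}
    (P : Partition G N) : ℝ :=
  ∑ e : Sym2 V,
    if e ∈ G.edgeSet ∧ ∀ k, ¬ (∀ v ∈ e, v ∈ P.part k) then g e else 0

/-- The deviation energy of a partition: the standard deviation of the masses
from the mean mass. -/
noncomputable def deviation {G : SimpleGraph V} (f : V → ℝ) {N : ℕ}
    (P : Partition G N) : ℝ :=
  Real.sqrt (∑ k : Fin N, (mass f (P.part k) - totalMass f / (N : ℝ)) ^ 2)

/-- The energy functional `F_λ`. -/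
noncomputable def energy (G : SimpleGraph V) (f : V → ℝ) (g : Sym2 V → ℝ)
    (lam : ℝ) {N : ℕ} (P : Partition G N) : ℝ :=
  lam * cutEnergy G g P + (1 - lam) * deviation f P

end Districting

namespace Districting

/-- The cut energy does not see the weight of an edge whose endpoints lie in the same part. -/
theorem cutEnergy_congr_of_mem_part {V : Type*} [Fintype V] [DecidableEq V] {G : SimpleGraph V}
    {N : ℕ} (P : Partition G N) {g g' : Sym2 V → ℝ} {v w : V} {k : Fin N}
    (hv : v ∈ P.part k) (hw : w ∈ P.part k) (h : ∀ e, e ≠ s(v, w) → g' e = g e) :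
    cutEnergy G g' P = cutEnergy G g P := by
  refine Finset.sum_congr rfl fun e _ => ?_
  split_ifs with hcut
  · refine h e ?_
    rintro rfl
    exact hcut.2 k (by simp [hv, hw])
  · rfl

/-- The weight of a cut edge is at most the cut energy. -/
theorem le_cutEnergy_of_cut {V : Type*} [Fintype V] [DecidableEq V] {G : SimpleGraph V}
    {N : ℕ} (P : Partition G N) {g : Sym2 V → ℝ} (hg : ∀ e ∈ G.edgeSet, 0 < g e) {e : Sym2 V}
    (he : e ∈ G.edgeSet) (hcut : ∀ k, ¬ ∀ v ∈ e, v ∈ P.part k) :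
    g e ≤ cutEnergy G g P := by
  unfold cutEnergy
  refine le_trans ?_ (Finset.single_le_sum (fun e _ => ?_) (Finset.mem_univ e))
  · rw [if_pos ⟨he, hcut⟩]
  split_ifs with h
  · exact (hg e h.1).le
  · exact le_rfl

/-- Theorem `2vertexes`: if two adjacent vertexes can be put in the
same district by some `N`-partition, then for any fixed `λ ∈ (0,1]` one can raise
the weight of their common edge above some threshold `c > 0` so that every
minimal `N`-partition places them in the same district. -/
theorem force_two_vertexes_together
    {V : Type*} [Fintype V] [DecidableEq V]
    (G : SimpleGraph V) (hG : G.Connected)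
    (f : V → ℝ) (hf : ∀ v, 0 < f v)
    (g : Sym2 V → ℝ) (hg : ∀ e ∈ G.edgeSet, 0 < g e)
    (v₁ v₂ : V) (hadj : G.Adj v₁ v₂) (N : ℕ)
    (hex : ∃ P : Partition G N, ∃ k, v₁ ∈ P.part k ∧ v₂ ∈ P.part k)
    (lam : ℝ) (hlam₀ : 0 < lam) (hlam₁ : lam ≤ 1) :
    ∃ c > (0 : ℝ), ∀ g' : Sym2 V → ℝ,
      (∀ e ∈ G.edgeSet, 0 < g' e) →
      (∀ e : Sym2 V, e ≠ s(v₁, v₂) → g' e = g e) →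
      g' s(v₁, v₂) > c →
      ∀ P : Partition G N,
        (∀ Q : Partition G N, energy G f g' lam P ≤ energy G f g' lam Q) →
        ∃ k, v₁ ∈ P.part k ∧ v₂ ∈ P.part k := by
  obtain ⟨P₀, k₀, h₁, h₂⟩ := hex
  refine ⟨max 1 (energy G f g lam P₀ / lam), lt_max_of_lt_left one_pos, ?_⟩
  intro g' hpos hagree hlarge P hmin
  by_contra! hsep
  have hcut : g' s(v₁, v₂) ≤ cutEnergy G g' P :=
    le_cutEnergy_of_cut P hpos hadj fun k hk =>
      hsep k (hk v₁ (Sym2.mem_mk_left _ _)) (hk v₂ (Sym2.mem_mk_right _ _))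
  have hP₀ : energy G f g' lam P₀ = energy G f g lam P₀ := by
    rw [energy, energy, cutEnergy_congr_of_mem_part P₀ h₁ h₂ hagree]
  have hlt : energy G f g lam P₀ < lam * g' s(v₁, v₂) :=
    (div_lt_iff₀' hlam₀).1 ((le_max_right _ _).trans_lt hlarge)
  have hdev : 0 ≤ (1 - lam) * deviation f P :=
    mul_nonneg (sub_nonneg.2 hlam₁) (Real.sqrt_nonneg _)
  have hle : lam * g' s(v₁, v₂) ≤ energy G f g' lam P :=
    (mul_le_mul_of_nonneg_left hcut hlam₀.le).trans (le_add_of_nonneg_right hdev)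
  linarith [hmin P₀]

end Districting
end

section
/- Let v ∈ V(Γ), let Γ_v = ({v}; ∅) be the singleton subgraph and Γ_v^c = (V(Γ)\{v}; E(Γ)\∂Γ_v) its complement, and assume Γ_v^c is connected, so that {Γ_v, Γ_v^c} is a 2-partition of Γ. Then there exist ε̄ > 0 and λ̄ ∈ [0,1) such that: for every edge weight g' agreeing with g on all edges not in ∂Γ_v and satisfying Σ_{e ∈ ∂Γ_v} g'(e) ≤ ε̄, and for every λ ∈ (λ̄, 1], every 2-partition minimizing F_λ (computed with weights f and g') has vertex partition {{v}, V(Γ)\{v}}. -/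
open Finset

namespace Districting

/-- The `2`-partition consisting of a single vertex and its connected complement. -/
def singletonPartition {V : Type*} [Fintype V] [DecidableEq V] (G : SimpleGraph V) (v : V)
    (hconn : (G.induce ({v}ᶜ : Set V)).Connected) : Partition G 2 where
  part := ![{v}, {v}ᶜ]
  disj k l hkl := by
    fin_cases k <;> fin_cases l <;> simp_all [disjoint_compl_left]
  covers w := by
    by_cases h : w = v
    · exact ⟨0, by simp [h]⟩
    · exact ⟨1, by simp [h]⟩
  connected k := by
    fin_cases k
    · have : ((({v} : Finset V) : Set V)) = {v} := by simp
      change (G.induce ((({v} : Finset V) : Set V))).Connected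
      rw [this]
      exact SimpleGraph.Connected.of_subsingleton
    · have : ((({v}ᶜ : Finset V) : Set V)) = {v}ᶜ := by simp
      change (G.induce ((({v}ᶜ : Finset V) : Set V))).Connected
      rw [this]
      exact hconn

/-- The cut set of the singleton partition is contained in the boundary of the vertex. -/
theorem cutEnergy_singletonPartition_le {V : Type*} [Fintype V] [DecidableEq V]
    (G : SimpleGraph V) (v : V) (hconn : (G.induce ({v}ᶜ : Set V)).Connected)
    (g : Sym2 V → ℝ) (hg : ∀ e ∈ G.edgeSet, 0 ≤ g e)
    [DecidablePred fun e : Sym2 V => e ∈ G.edgeSet ∧ v ∈ e] :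
    cutEnergy G g (singletonPartition G v hconn) ≤
      ∑ e : Sym2 V, if e ∈ G.edgeSet ∧ v ∈ e then g e else 0 := by
  unfold cutEnergy
  refine Finset.sum_le_sum fun e _ => ?_
  split_ifs with h₁ h₂ h₂
  · exact le_rfl
  · refine absurd (fun w hw => ?_) (h₁.2 1)
    have : w ≠ v := fun h => h₂ ⟨h₁.1, h ▸ hw⟩
    simpa [singletonPartition] using this
  · exact hg e h₂.1
  · exact le_rfl

/-- The weight of a cut edge bounds the cut energy from below. -/
theorem le_cutEnergy {V : Type*} [Fintype V] [DecidableEq V] (G : SimpleGraph V)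
    (g : Sym2 V → ℝ) (hg : ∀ e ∈ G.edgeSet, 0 ≤ g e) {N : ℕ} (P : Partition G N)
    {e : Sym2 V} (he : e ∈ G.edgeSet) (hcut : ∀ k, ¬ ∀ w ∈ e, w ∈ P.part k) :
    g e ≤ cutEnergy G g P := by
  classical
  unfold cutEnergy
  refine le_trans (le_of_eq (if_pos ⟨he, hcut⟩).symm)
    (Finset.single_le_sum (f := fun e : Sym2 V =>
      if e ∈ G.edgeSet ∧ ∀ k, ¬ (∀ v ∈ e, v ∈ P.part k) then g e else 0)
      (fun e _ => ?_) (Finset.mem_univ e))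
  split_ifs with h
  · exact hg e h.1
  · exact le_rfl

/-- If no part of a `2`-partition is `{v}` and the complement of `v` is connected, then some
edge avoiding `v` is cut. -/
theorem exists_cut_edge_not_mem {V : Type*} [Fintype V] [DecidableEq V] (G : SimpleGraph V)
    (v : V) (hconn : (G.induce ({v}ᶜ : Set V)).Connected) (P : Partition G 2)
    (hP : ∀ k, P.part k ≠ {v}) :
    ∃ e ∈ G.edgeSet, v ∉ e ∧ ∀ k, ¬ ∀ w ∈ e, w ∈ P.part k := by
  have hne : ∀ k, ∃ w ∈ P.part k, w ≠ v := by
    intro k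
    by_contra! h
    obtain ⟨w, hw⟩ := (P.connected k).nonempty
    have hw' : w ∈ P.part k := by simpa using hw
    exact hP k (Finset.eq_singleton_iff_unique_mem.2 ⟨h w hw' ▸ hw', h⟩)
  obtain ⟨a, ha, hav⟩ := hne 0
  obtain ⟨b, hb, hbv⟩ := hne 1
  have hdisj : ∀ w, w ∈ P.part 0 → w ∉ P.part 1 :=
    fun _ hw => Finset.disjoint_left.1 (P.disj 0 1 (by decide)) hw
  obtain ⟨p⟩ := hconn.preconnected ⟨a, hav⟩ ⟨b, hbv⟩
  obtain ⟨d, -, h₀, h₁⟩ := p.exists_boundary_dart {w | w.1 ∈ P.part 0} ha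
    (fun h => hdisj b h hb)
  refine ⟨s(d.fst.1, d.snd.1), d.adj, ?_, fun k hk => ?_⟩
  · rw [Sym2.mem_iff]
    rintro (h | h)
    · exact d.fst.2 h.symm
    · exact d.snd.2 h.symm
  · fin_cases k
    · exact h₁ (hk _ (Sym2.mem_mk_right _ _))
    · exact hdisj _ h₀ (hk _ (Sym2.mem_mk_left _ _))

/-- The edge weights of a finite graph are bounded below by a positive constant. -/
theorem exists_pos_le_weight {V : Type*} [Fintype V] (G : SimpleGraph V)
    (g : Sym2 V → ℝ) (hg : ∀ e ∈ G.edgeSet, 0 < g e) :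
    ∃ m > 0, ∀ e ∈ G.edgeSet, m ≤ g e := by
  rcases G.edgeSet.eq_empty_or_nonempty with h | h
  · exact ⟨1, one_pos, by simp [h]⟩
  · obtain ⟨e₀, he₀, hmin⟩ := Set.exists_min_image G.edgeSet g (Set.toFinite _) h
    exact ⟨g e₀, hg e₀ he₀, hmin⟩

open Classical in
/-- Theorem `thm:isolated`: if the complement of the singleton `{v}`
is connected (so that `{Γ_v, Γ_v^c}` is a `2`-partition), then there are `ε̄ > 0`
and `λ̄ ∈ [0,1)` such that for every edge weight `g'` agreeing with `g` away from
`∂Γ_v` with boundary weight at most `ε̄`, and every `λ ∈ (λ̄, 1]`, every minimal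
`2`-partition has vertex partition `{{v}, V \ {v}}`. -/
theorem force_isolated_vertex
    {V : Type*} [Fintype V] [DecidableEq V]
    (G : SimpleGraph V) (hG : G.Connected)
    (f : V → ℝ) (hf : ∀ v, 0 < f v)
    (g : Sym2 V → ℝ) (hg : ∀ e ∈ G.edgeSet, 0 < g e)
    (v : V) (hconn : (G.induce ({v}ᶜ : Set V)).Connected) :
    ∃ εbar > (0 : ℝ), ∃ lambar : ℝ, 0 ≤ lambar ∧ lambar < 1 ∧
      ∀ g' : Sym2 V → ℝ,
        (∀ e ∈ G.edgeSet, 0 < g' e) →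
        (∀ e : Sym2 V, v ∉ e → g' e = g e) →
        (∑ e : Sym2 V, if e ∈ G.edgeSet ∧ v ∈ e then g' e else 0) ≤ εbar →
        ∀ lam : ℝ, lambar < lam → lam ≤ 1 →
          ∀ P : Partition G 2,
            (∀ Q : Partition G 2, energy G f g' lam P ≤ energy G f g' lam Q) →
            ∃ k, P.part k = ({v} : Finset V) := by
  obtain ⟨m, hm, hmg⟩ := exists_pos_le_weight G g hg
  set Q := singletonPartition G v hconn with hQ
  have hD : 0 ≤ deviation f Q := Real.sqrt_nonneg _
  have hpos : 0 < m / 2 + deviation f Q := by linarith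
  refine ⟨m / 2, by linarith, deviation f Q / (m / 2 + deviation f Q), by positivity, ?_, ?_⟩
  · rw [div_lt_one hpos]
    linarith
  intro g' hg' hgg' hsum lam hlam hlam1 P hmin
  by_contra! hP
  obtain ⟨e, he, hve, hcut⟩ := exists_cut_edge_not_mem G v hconn P hP
  have hg'0 : ∀ e ∈ G.edgeSet, 0 ≤ g' e := fun e he => (hg' e he).le
  have hPcut : m ≤ cutEnergy G g' P :=
    ((hmg e he).trans_eq (hgg' e hve).symm).trans (le_cutEnergy G g' hg'0 P he hcut)
  have hQcut : cutEnergy G g' Q ≤ m / 2 :=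
    (cutEnergy_singletonPartition_le G v hconn g' hg'0).trans hsum
  have hlam0 : 0 ≤ lam := le_trans (by positivity) hlam.le
  have hPdev : 0 ≤ (1 - lam) * deviation f P :=
    mul_nonneg (by linarith) (Real.sqrt_nonneg _)
  have hle := hmin Q
  unfold energy at hle
  rw [div_lt_iff₀ hpos] at hlam
  have h₁ := mul_le_mul_of_nonneg_left hPcut hlam0
  have h₂ := mul_le_mul_of_nonneg_left hQcut hlam0
  linarith

end Districting
end

section
/- Let Γ be the 8-cycle with vertexes b₁, b₂, b₃, b₄, t₄, t₃, t₂, t₁ in cyclic order, all of vertex weight 1, and edge weights: g(b₁b₂) = 4, g(b₂b₃) = 10, g(b₃b₄) = 4, g(b₄t₄) = 1, g(t₄t₃) = 2, g(t₃t₂) = 10, g(t₂t₁) = 2, g(t₁b₁) = 1. Then: (a) for every λ ∈ (0,1) the unique minimal 2-partition is {{b₁,b₂,b₃,b₄},{t₁,t₂,t₃,t₄}} (cut energy 2, deviation energy 0); (b) the 4-partition D = {{t₁,b₁},{b₂,b₃},{b₄,t₄},{t₂,t₃}} (cut energy 12, deviation energy 0) minimizes F_λ exactly for λ ∈ [0,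 √6/(6+√6)], and the 4-partition C = {{t₁},{b₁,b₂,b₃,b₄},{t₄},{t₂,t₃}} (cut energy 6, deviation energy √6) minimizes F_λ exactly for λ ∈ [√6/(6+√6), 1]; (c) consequently, for every λ ∈ (0,1), no minimal 4-partition of F_λ is a 2-refining of the unique minimal 2-partition of F_λ. -/
open Finset

namespace Districting

/-- `Q` is a `j`-refining of `P`: up to relabelling, `Q` splits each part of `P`
into exactly `j` parts. -/
def IsRefining {V : Type*} [Fintype V] [DecidableEq V]
    {G : SimpleGraph V} {M N : ℕ} (j : ℕ)
    (Q : Partition G M) (P : Partition G N) : Prop :=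
  ∃ φ : Fin M → Fin N,
    (∀ i, Q.part i ⊆ P.part (φ i)) ∧
      ∀ k, (Finset.univ.filter (fun i => φ i = k)).card = j

end Districting

namespace Districting

/-- The 8-cycle with vertexes `b₁ = 0`, `b₂ = 1`, `b₃ = 2`, `b₄ = 3`, `t₄ = 4`,
`t₃ = 5`, `t₂ = 6`, `t₁ = 7` in cyclic order. -/
def cycleGraph8 : SimpleGraph (Fin 8) :=
  SimpleGraph.fromRel (fun u v => v = u + 1)

/-- The vertex partition of the `4`-partition `D`. -/
def rangeD : Set (Finset (Fin 8)) :=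
  {({7, 0} : Finset (Fin 8)), ({1, 2} : Finset (Fin 8)),
    ({3, 4} : Finset (Fin 8)), ({5, 6} : Finset (Fin 8))}

/-- The vertex partition of the `4`-partition `C`. -/
def rangeC : Set (Finset (Fin 8)) :=
  {({7} : Finset (Fin 8)), ({0, 1, 2, 3} : Finset (Fin 8)),
    ({4} : Finset (Fin 8)), ({5, 6} : Finset (Fin 8))}

/-- The vertex partition of the minimal `2`-partition. -/
def rangeBT : Set (Finset (Fin 8)) :=
  {({0, 1, 2, 3} : Finset (Fin 8)), ({4, 5, 6, 7} : Finset (Fin 8))}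

/-- The arc of vertexes whose first vertex of `T` in increasing cyclic order is `i` (for `i ∈ T`). -/
def arc (T : Finset (Fin 8)) (i : Fin 8) : Finset (Fin 8) :=
  univ.filter fun v => ∀ d < i - v, v + d ∉ T

/-- The weight of the edge joining `i` to `i + 1`. -/
def edgeWeight : Fin 8 → ℕ := ![4, 10, 4, 1, 2, 10, 2, 1]

/-- The sum of the squared deviations from `m` of the sizes of the arcs cut out by `T`. -/
def sqDev (m : ℤ) (T : Finset (Fin 8)) : ℤ := ∑ i ∈ T, (((arc T i).card : ℤ) - m) ^ 2

theorem cycleGraph8_adj {u v : Fin 8} : cycleGraph8.Adj u v ↔ v = u + 1 ∨ u = v + 1 := by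
  simp only [cycleGraph8, SimpleGraph.fromRel_adj, and_iff_right_iff_imp]
  revert u v
  decide

theorem eq_of_connected_of_boundary {S : Finset (Fin 8)}
    (hS : (cycleGraph8.induce (S : Set (Fin 8))).Connected) {i j : Fin 8}
    (hi : i ∈ S) (hi' : i + 1 ∉ S) (hj : j ∈ S) (hj' : j + 1 ∉ S) : i = j := by
  by_contra hij
  obtain ⟨w⟩ := hS.preconnected ⟨i, hi⟩ ⟨j, hj⟩
  obtain ⟨d, -, h₁, h₂⟩ := w.exists_boundary_dart {v | v.1 - (j + 1) ≤ i - (j + 1)}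
    (by simp) (by
      simp only [Set.mem_ofPred_eq]
      clear w hi hi' hj hj'
      revert i j
      decide)
  have hadj : cycleGraph8.Adj d.fst.1 d.snd.1 := d.adj
  have hu : d.fst.1 ∈ S := d.fst.2
  have hv : d.snd.1 ∈ S := d.snd.2
  simp only [Set.mem_ofPred_eq] at h₁ h₂
  generalize d.fst.1 = u at *
  generalize d.snd.1 = v at *
  rcases cycleGraph8_adj.1 hadj with rfl | rfl
  · have key : ∀ i j u : Fin 8, i ≠ j → u - (j + 1) ≤ i - (j + 1) →
        ¬ u + 1 - (j + 1) ≤ i - (j + 1) → u = i := by decide +kernel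
    exact hi' (key i j u hij h₁ h₂ ▸ hv)
  · have key : ∀ i j v : Fin 8, i ≠ j → v + 1 - (j + 1) ≤ i - (j + 1) →
        ¬ v - (j + 1) ≤ i - (j + 1) → v = j := by decide +kernel
    exact hj' (key i j v hij h₁ h₂ ▸ hu)

theorem exists_boundary {S : Finset (Fin 8)} (hS : S.Nonempty) (hS' : S ≠ univ) :
    ∃ i ∈ S, i + 1 ∉ S := by
  revert S
  decide +kernel

/-- The vertexes `i` such that the edge from `i` to `i + 1` is cut. -/
def cutSet {N : ℕ} (P : Partition cycleGraph8 N) : Finset (Fin 8) :=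
  univ.filter fun i => ∀ k, ¬ (i ∈ P.part k ∧ i + 1 ∈ P.part k)

theorem mem_cutSet {N : ℕ} {P : Partition cycleGraph8 N} {i : Fin 8} :
    i ∈ cutSet P ↔ ∀ k, ¬ (i ∈ P.part k ∧ i + 1 ∈ P.part k) := by
  simp [cutSet]

theorem Partition.eq_of_mem {V : Type*} [Fintype V] [DecidableEq V] {G : SimpleGraph V} {N : ℕ}
    (P : Partition G N) {v : V} {k l : Fin N} (hk : v ∈ P.part k) (hl : v ∈ P.part l) : k = l := by
  by_contra h
  exact Finset.disjoint_left.1 (P.disj k l h) hk hl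

theorem Partition.nonempty {V : Type*} [Fintype V] [DecidableEq V] {G : SimpleGraph V} {N : ℕ}
    (P : Partition G N) (k : Fin N) : (P.part k).Nonempty := by
  obtain ⟨v⟩ := (P.connected k).nonempty
  exact ⟨v.1, v.2⟩

theorem Partition.ne_univ {V : Type*} [Fintype V] [DecidableEq V] {G : SimpleGraph V} {N : ℕ}
    (hN : 2 ≤ N) (P : Partition G N) (k : Fin N) : P.part k ≠ univ := by
  intro h
  have : Nontrivial (Fin N) := Fin.nontrivial_iff_two_le.2 hN
  obtain ⟨l, hl⟩ := exists_ne k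
  obtain ⟨v, hv⟩ := P.nonempty l
  exact hl (P.eq_of_mem hv (h ▸ mem_univ v))

theorem exists_first_mem {T : Finset (Fin 8)} (hT : T.Nonempty) (v : Fin 8) :
    ∃ d : Fin 8, v + d ∈ T ∧ ∀ e < d, v + e ∉ T := by
  obtain ⟨t, ht⟩ := hT
  have hne : (univ.filter fun d : Fin 8 => v + d ∈ T).Nonempty := ⟨t - v, by simpa using ht⟩
  refine ⟨_, (mem_filter.1 (min'_mem _ hne)).2, fun e he h => ?_⟩
  exact absurd (min'_le _ e (by simpa using h)) (not_le.2 he)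

theorem add_mem_part {N : ℕ} {P : Partition cycleGraph8 N} {v : Fin 8} {k : Fin N}
    (hv : v ∈ P.part k) (d : Fin 8) (hd : ∀ e < d, v + e ∉ cutSet P) : v + d ∈ P.part k := by
  induction d using Fin.induction with
  | zero => simpa using hv
  | succ d ih =>
    have hlt : d.castSucc < d.succ := Fin.castSucc_lt_succ
    have h₁ := ih fun e he => hd e (he.trans hlt)
    have h₂ := hd _ hlt
    simp only [mem_cutSet, not_forall, not_not] at h₂
    obtain ⟨l, hl, hl'⟩ := h₂
    obtain rfl := P.eq_of_mem h₁ hl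
    rwa [← Fin.coeSucc_eq_succ, ← add_assoc]

theorem exists_arc {N : ℕ} (hN : 2 ≤ N) (P : Partition cycleGraph8 N) :
    ∃ ι : Fin N → Fin 8, Function.Injective ι ∧ univ.image ι = cutSet P ∧
      ∀ k, P.part k = arc (cutSet P) (ι k) := by
  choose ι hι hι' using fun k => exists_boundary (P.nonempty k) (P.ne_univ hN k)
  have hcut : ∀ k, ι k ∈ cutSet P := fun k => mem_cutSet.2 fun l hl =>
    hι' k (P.eq_of_mem hl.1 (hι k) ▸ hl.2)
  have huniq : ∀ k i, i ∈ P.part k → i ∈ cutSet P → i = ι k := fun k i hi hc =>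
    eq_of_connected_of_boundary (P.connected k) hi (fun h => mem_cutSet.1 hc k ⟨hi, h⟩)
      (hι k) (hι' k)
  refine ⟨ι, fun k l h => P.eq_of_mem (hι k) (h ▸ hι l), ?_, fun k => ?_⟩
  · ext i
    simp only [mem_image, mem_univ, true_and]
    constructor
    · rintro ⟨k, rfl⟩
      exact hcut k
    · intro hi
      obtain ⟨k, hk⟩ := P.covers i
      exact ⟨k, (huniq k i hk hi).symm⟩
  · ext v
    simp only [arc, mem_filter, mem_univ, true_and]
    constructor
    · intro hv
      obtain ⟨d, hd, hd'⟩ := exists_first_mem ⟨_, hcut k⟩ v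
      rw [← huniq k _ (add_mem_part hv d hd') hd]
      simpa using hd'
    · intro h
      obtain ⟨l, hl⟩ := P.covers v
      have h' := add_mem_part hl _ h
      rw [add_sub_cancel] at h'
      rwa [P.eq_of_mem (hι k) h']

theorem card_cutSet {N : ℕ} (hN : 2 ≤ N) (P : Partition cycleGraph8 N) : (cutSet P).card = N := by
  obtain ⟨ι, hι, himg, -⟩ := exists_arc hN P
  rw [← himg, card_image_of_injective _ hι, card_univ, Fintype.card_fin]

theorem range_part {N : ℕ} (hN : 2 ≤ N) (P : Partition cycleGraph8 N) :
    Set.range P.part = ((cutSet P).image (arc (cutSet P)) : Finset (Finset (Fin 8))) := by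
  obtain ⟨ι, -, himg, hpart⟩ := exists_arc hN P
  have : P.part = arc (cutSet P) ∘ ι := funext hpart
  rw [coe_image, this, Set.range_comp]
  congr 1
  rw [← himg]
  simp

theorem deviation_eq {N : ℕ} (hN : 2 ≤ N) {m : ℤ} (hm : (8 : ℝ) / N = m)
    {f : Fin 8 → ℝ} (hf : ∀ v, f v = 1) (P : Partition cycleGraph8 N) :
    deviation f P = Real.sqrt (sqDev m (cutSet P)) := by
  obtain ⟨ι, hι, himg, hpart⟩ := exists_arc hN P
  have hsum : sqDev m (cutSet P) = ∑ k, (((P.part k).card : ℤ) - m) ^ 2 := by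
    simp only [sqDev, hpart]
    conv_lhs => rw [← himg]
    rw [sum_image hι.injOn, himg]
  rw [deviation, hsum]
  push_cast
  simp [mass, totalMass, hf, hm]

theorem mem_edgeSet_cycleGraph8 {e : Sym2 (Fin 8)} :
    e ∈ cycleGraph8.edgeSet ↔ ∃ i, s(i, i + 1) = e := by
  induction e with
  | h u v =>
    simp only [SimpleGraph.mem_edgeSet, cycleGraph8_adj, Sym2.eq_iff]
    constructor
    · rintro (rfl | rfl)
      · exact ⟨u, by simp⟩
      · exact ⟨v, by simp⟩
    · rintro ⟨i, ⟨rfl, rfl⟩ | ⟨rfl, rfl⟩⟩ <;> simp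

theorem cutEnergy_eq {N : ℕ} {g : Sym2 (Fin 8) → ℝ} (hg : ∀ i, g s(i, i + 1) = edgeWeight i)
    (P : Partition cycleGraph8 N) :
    cutEnergy cycleGraph8 g P = ((∑ i ∈ cutSet P, edgeWeight i : ℕ) : ℝ) := by
  classical
  have hinj : Function.Injective fun i : Fin 8 => s(i, i + 1) := by decide
  have hmem : ∀ e : Sym2 (Fin 8),
      (e ∈ cycleGraph8.edgeSet ∧ ∀ k, ¬ (∀ v ∈ e, v ∈ P.part k)) ↔
        e ∈ (cutSet P).image fun i => s(i, i + 1) := by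
    intro e
    simp only [mem_image, mem_edgeSet_cycleGraph8, mem_cutSet]
    constructor
    · rintro ⟨⟨i, rfl⟩, h⟩
      exact ⟨i, by simpa using h, rfl⟩
    · rintro ⟨i, h, rfl⟩
      exact ⟨⟨i, rfl⟩, by simpa using h⟩
  simp only [cutEnergy, hmem]
  rw [sum_ite_mem, univ_inter]
  rw [sum_image hinj.injOn]
  push_cast
  exact sum_congr rfl fun i _ => hg i

theorem isConnected_singleton (i : Fin 8) :
    (cycleGraph8.induce (({i} : Finset (Fin 8)) : Set (Fin 8))).Connected := by
  rw [coe_singleton]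
  simp

theorem isConnected_pair (i : Fin 8) :
    (cycleGraph8.induce (({i, i + 1} : Finset (Fin 8)) : Set (Fin 8))).Connected := by
  rw [coe_pair]
  exact SimpleGraph.induce_pair_connected_of_adj (cycleGraph8_adj.2 (Or.inl rfl))

theorem isConnected_quadruple (i : Fin 8) :
    (cycleGraph8.induce
      (({i, i + 1, i + 2, i + 3} : Finset (Fin 8)) : Set (Fin 8))).Connected := by
  have hadj : cycleGraph8.Adj (i + 1) (i + 2) := by
    rw [cycleGraph8_adj]
    revert i
    decide
  have h := SimpleGraph.connected_induce_union (isConnected_pair i).preconnected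
    (isConnected_pair (i + 2)).preconnected (v := i + 1) (w := i + 2) (by simp) (by simp) hadj
  have hset : ({i, i + 1, i + 2, i + 3} : Finset (Fin 8)) = {i, i + 1} ∪ {i + 2, i + 2 + 1} := by
    clear h hadj
    revert i
    decide
  rwa [hset, coe_union]

theorem exists_partition_rangeBT : ∃ P : Partition cycleGraph8 2, Set.range P.part = rangeBT := by
  refine ⟨⟨![{0, 1, 2, 3}, {4, 5, 6, 7}], by decide, by decide, ?_⟩, ?_⟩
  · intro k
    fin_cases k
    · exact isConnected_quadruple 0
    · exact isConnected_quadruple 4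
  · ext S
    simp [rangeBT]
    tauto

theorem exists_partition_rangeD : ∃ P : Partition cycleGraph8 4, Set.range P.part = rangeD := by
  refine ⟨⟨![{7, 0}, {1, 2}, {3, 4}, {5, 6}], by decide, by decide, ?_⟩, ?_⟩
  · intro k
    fin_cases k
    · exact isConnected_pair 7
    · exact isConnected_pair 1
    · exact isConnected_pair 3
    · exact isConnected_pair 5
  · ext S
    simp [rangeD]
    tauto

theorem exists_partition_rangeC : ∃ P : Partition cycleGraph8 4, Set.range P.part = rangeC := by
  refine ⟨⟨![{7}, {0, 1, 2, 3}, {4}, {5, 6}], by decide, by decide, ?_⟩, ?_⟩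
  · intro k
    fin_cases k
    · exact isConnected_singleton 7
    · exact isConnected_quadruple 0
    · exact isConnected_singleton 4
    · exact isConnected_pair 5
  · ext S
    simp [rangeC]
    tauto

theorem range_eq_rangeBT_iff (P : Partition cycleGraph8 2) :
    Set.range P.part = rangeBT ↔ cutSet P = {3, 7} := by
  have key : ∀ T : Finset (Fin 8), T.card = 2 →
      (T.image (arc T) = {{0, 1, 2, 3}, {4, 5, 6, 7}} ↔ T = {3, 7}) := by decide +kernel
  rw [← key _ (card_cutSet le_rfl P), range_part le_rfl, ← coe_inj]
  simp [rangeBT]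

theorem cutSet_of_range_eq_rangeD {P : Partition cycleGraph8 4} (h : Set.range P.part = rangeD) :
    cutSet P = {0, 2, 4, 6} := by
  have key : ∀ T : Finset (Fin 8), T.card = 4 →
      T.image (arc T) = {{7, 0}, {1, 2}, {3, 4}, {5, 6}} → T = {0, 2, 4, 6} := by decide +kernel
  apply key _ (card_cutSet (by norm_num) P)
  rw [← coe_inj, ← range_part (by norm_num), h]
  simp [rangeD]

theorem cutSet_of_range_eq_rangeC {P : Partition cycleGraph8 4} (h : Set.range P.part = rangeC) :
    cutSet P = {3, 4, 6, 7} := by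
  have key : ∀ T : Finset (Fin 8), T.card = 4 →
      T.image (arc T) = {{7}, {0, 1, 2, 3}, {4}, {5, 6}} → T = {3, 4, 6, 7} := by decide +kernel
  apply key _ (card_cutSet (by norm_num) P)
  rw [← coe_inj, ← range_part (by norm_num), h]
  simp [rangeC]

theorem cost_bounds_of_card_eq_four : ∀ T : Finset (Fin 8), T.card = 4 →
    (12 ≤ ∑ i ∈ T, edgeWeight i ∧ 0 ≤ sqDev 2 T) ∨
    (9 ≤ ∑ i ∈ T, edgeWeight i ∧ 2 ≤ sqDev 2 T) ∨
    (8 ≤ ∑ i ∈ T, edgeWeight i ∧ 4 ≤ sqDev 2 T) ∨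
    (6 ≤ ∑ i ∈ T, edgeWeight i ∧ 6 ≤ sqDev 2 T) := by
  decide +kernel

theorem cost_bounds_of_separated : ∀ T : Finset (Fin 8), T.card = 4 → 3 ∈ T → 7 ∈ T →
    2 ≤ (T ∩ {0, 1, 2, 3}).card → 2 ≤ (T ∩ {4, 5, 6, 7}).card →
    (14 ≤ ∑ i ∈ T, edgeWeight i ∧ 0 ≤ sqDev 2 T) ∨
    (8 ≤ ∑ i ∈ T, edgeWeight i ∧ 4 ≤ sqDev 2 T) := by
  decide +kernel

theorem cost_bound_of_card_eq_two : ∀ T : Finset (Fin 8), T.card = 2 →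
    T = {3, 7} ∨ 3 ≤ ∑ i ∈ T, edgeWeight i := by
  decide +kernel

theorem le_sqrt_of_le_intCast {a : ℝ} {n : ℤ} {m : ℕ} (hn : (m : ℤ) ≤ n) (ha : a ^ 2 ≤ m) :
    a ≤ Real.sqrt n :=
  Real.le_sqrt_of_sq_le (ha.trans (by exact_mod_cast hn))

theorem six_le_and_twelve_le {T : Finset (Fin 8)} (hT : T.card = 4) :
    (6 : ℝ) ≤ (∑ i ∈ T, edgeWeight i : ℕ) ∧
      12 ≤ ((∑ i ∈ T, edgeWeight i : ℕ) : ℝ) + Real.sqrt 6 * Real.sqrt (sqDev 2 T) := by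
  have h6 : (2.44 : ℝ) ≤ Real.sqrt 6 := Real.le_sqrt_of_sq_le (by norm_num)
  have h66 : Real.sqrt 6 * Real.sqrt 6 = 6 := Real.mul_self_sqrt (by norm_num)
  have hd : 0 ≤ Real.sqrt (sqDev 2 T) := Real.sqrt_nonneg _
  rcases cost_bounds_of_card_eq_four T hT with ⟨hc, h⟩ | ⟨hc, h⟩ | ⟨hc, h⟩ | ⟨hc, h⟩
  · have hc' : (12 : ℝ) ≤ (∑ i ∈ T, edgeWeight i : ℕ) := by exact_mod_cast hc
    exact ⟨by linarith, by nlinarith⟩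
  · have hc' : (9 : ℝ) ≤ (∑ i ∈ T, edgeWeight i : ℕ) := by exact_mod_cast hc
    have := le_sqrt_of_le_intCast (a := 1.4) (m := 2) h (by norm_num)
    exact ⟨by linarith, by nlinarith⟩
  · have hc' : (8 : ℝ) ≤ (∑ i ∈ T, edgeWeight i : ℕ) := by exact_mod_cast hc
    have := le_sqrt_of_le_intCast (a := 2) (m := 4) h (by norm_num)
    exact ⟨by linarith, by nlinarith⟩
  · have hc' : (6 : ℝ) ≤ (∑ i ∈ T, edgeWeight i : ℕ) := by exact_mod_cast hc
    have := le_sqrt_of_le_intCast (a := Real.sqrt 6) (m := 6) h (by norm_num)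
    exact ⟨by linarith, by nlinarith⟩

/-- Example `refining`: on the 8-cycle with unit vertex weights
and edge weights `4, 10, 4, 1, 2, 10, 2, 1`: (a) for `λ ∈ (0,1)` the unique
minimal `2`-partition is `{{b₁,...,b₄},{t₁,...,t₄}}`; (b) `D` minimizes `F_λ`
exactly for `λ ∈ [0, √6/(6+√6)]` and `C` exactly for `λ ∈ [√6/(6+√6), 1]`;
(c) for `λ ∈ (0,1)` no minimal `4`-partition is a `2`-refining of the minimal
`2`-partition. -/
theorem cycle8_no_refining
    (f : Fin 8 → ℝ) (hf : ∀ v, f v = 1)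
    (g : Sym2 (Fin 8) → ℝ)
    (hg₀₁ : g s(0, 1) = 4) (hg₁₂ : g s(1, 2) = 10) (hg₂₃ : g s(2, 3) = 4)
    (hg₃₄ : g s(3, 4) = 1) (hg₄₅ : g s(4, 5) = 2) (hg₅₆ : g s(5, 6) = 10)
    (hg₆₇ : g s(6, 7) = 2) (hg₇₀ : g s(7, 0) = 1) :
    -- (a)
    (∀ lam : ℝ, 0 < lam → lam < 1 → ∀ P : Partition cycleGraph8 2,
      (∀ Q : Partition cycleGraph8 2,
          energy cycleGraph8 f g lam P ≤ energy cycleGraph8 f g lam Q) ↔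
        Set.range P.part = rangeBT) ∧
    -- (b)
    ((∃ P : Partition cycleGraph8 4, Set.range P.part = rangeD) ∧
      (∃ P : Partition cycleGraph8 4, Set.range P.part = rangeC) ∧
      (∀ lam ∈ Set.Icc (0 : ℝ) 1, ∀ P : Partition cycleGraph8 4,
        Set.range P.part = rangeD →
          ((∀ Q : Partition cycleGraph8 4,
              energy cycleGraph8 f g lam P ≤ energy cycleGraph8 f g lam Q) ↔
            lam ≤ Real.sqrt 6 / (6 + Real.sqrt 6))) ∧
      (∀ lam ∈ Set.Icc (0 : ℝ) 1, ∀ P : Partition cycleGraph8 4,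
        Set.range P.part = rangeC →
          ((∀ Q : Partition cycleGraph8 4,
              energy cycleGraph8 f g lam P ≤ energy cycleGraph8 f g lam Q) ↔
            Real.sqrt 6 / (6 + Real.sqrt 6) ≤ lam))) ∧
    -- (c)
    (∀ lam : ℝ, 0 < lam → lam < 1 →
      ∀ Q : Partition cycleGraph8 4,
        (∀ R : Partition cycleGraph8 4,
            energy cycleGraph8 f g lam Q ≤ energy cycleGraph8 f g lam R) →
        ∀ P : Partition cycleGraph8 2,
          (∀ R : Partition cycleGraph8 2,
              energy cycleGraph8 f g lam P ≤ energy cycleGraph8 f g lam R) →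
          ¬ IsRefining 2 Q P) := by
  have hg : ∀ i, g s(i, i + 1) = edgeWeight i := by
    intro i
    fin_cases i <;> simp [edgeWeight] <;> assumption
  have hE₂ : ∀ lam (P : Partition cycleGraph8 2), energy cycleGraph8 f g lam P =
      lam * (∑ i ∈ cutSet P, edgeWeight i : ℕ) + (1 - lam) * Real.sqrt (sqDev 4 (cutSet P)) := by
    intro lam P
    rw [energy, cutEnergy_eq hg, deviation_eq le_rfl (m := 4) (by norm_num) hf]
  have hE₄ : ∀ lam (P : Partition cycleGraph8 4), energy cycleGraph8 f g lam P =
      lam * (∑ i ∈ cutSet P, edgeWeight i : ℕ) + (1 - lam) * Real.sqrt (sqDev 2 (cutSet P)) := by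
    intro lam P
    rw [energy, cutEnergy_eq hg, deviation_eq (by norm_num) (m := 2) (by norm_num) hf]
  have hBT : ∀ lam (P : Partition cycleGraph8 2), Set.range P.part = rangeBT →
      energy cycleGraph8 f g lam P = lam * 2 := by
    intro lam P hP
    have h₁ : ∑ i ∈ ({3, 7} : Finset (Fin 8)), edgeWeight i = 2 := by decide
    have h₂ : sqDev 4 {3, 7} = 0 := by decide +kernel
    rw [hE₂, (range_eq_rangeBT_iff P).1 hP, h₁, h₂]
    simp
  have hD : ∀ lam (P : Partition cycleGraph8 4), Set.range P.part = rangeD →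
      energy cycleGraph8 f g lam P = lam * 12 := by
    intro lam P hP
    have h₁ : ∑ i ∈ ({0, 2, 4, 6} : Finset (Fin 8)), edgeWeight i = 12 := by decide
    have h₂ : sqDev 2 {0, 2, 4, 6} = 0 := by decide +kernel
    rw [hE₄, cutSet_of_range_eq_rangeD hP, h₁, h₂]
    simp
  have hC : ∀ lam (P : Partition cycleGraph8 4), Set.range P.part = rangeC →
      energy cycleGraph8 f g lam P = lam * 6 + (1 - lam) * Real.sqrt 6 := by
    intro lam P hP
    have h₁ : ∑ i ∈ ({3, 4, 6, 7} : Finset (Fin 8)), edgeWeight i = 6 := by decide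
    have h₂ : sqDev 2 {3, 4, 6, 7} = 6 := by decide +kernel
    rw [hE₄, cutSet_of_range_eq_rangeC hP, h₁, h₂]
    simp
  have hs : 0 < Real.sqrt 6 := by positivity
  have hss : Real.sqrt 6 * Real.sqrt 6 = 6 := Real.mul_self_sqrt (by norm_num)
  have ha : ∀ lam : ℝ, 0 < lam → lam < 1 → ∀ P : Partition cycleGraph8 2,
      (∀ Q : Partition cycleGraph8 2,
          energy cycleGraph8 f g lam P ≤ energy cycleGraph8 f g lam Q) ↔
        Set.range P.part = rangeBT := by
    intro lam h0 h1 P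
    constructor
    · intro h
      obtain ⟨Q, hQ⟩ := exists_partition_rangeBT
      have hle := h Q
      rw [hBT lam Q hQ, hE₂] at hle
      rw [range_eq_rangeBT_iff]
      refine (cost_bound_of_card_eq_two _ (card_cutSet le_rfl P)).resolve_right fun h3 => ?_
      have h3' : (3 : ℝ) ≤ (∑ i ∈ cutSet P, edgeWeight i : ℕ) := by exact_mod_cast h3
      nlinarith [mul_nonneg (sub_nonneg.2 h1.le) (Real.sqrt_nonneg (sqDev 4 (cutSet P)))]
    · intro hP Q
      rcases cost_bound_of_card_eq_two _ (card_cutSet le_rfl Q) with h | h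
      · rw [hBT lam P hP, hBT lam Q ((range_eq_rangeBT_iff Q).2 h)]
      · have h3' : (3 : ℝ) ≤ (∑ i ∈ cutSet Q, edgeWeight i : ℕ) := by exact_mod_cast h
        rw [hBT lam P hP, hE₂]
        nlinarith [mul_nonneg (sub_nonneg.2 h1.le) (Real.sqrt_nonneg (sqDev 4 (cutSet Q)))]
  obtain ⟨PD, hPD⟩ := exists_partition_rangeD
  obtain ⟨PC, hPC⟩ := exists_partition_rangeC
  refine ⟨ha, ⟨⟨PD, hPD⟩, ⟨PC, hPC⟩, ?_, ?_⟩, ?_⟩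
  · rintro lam ⟨h0, h1⟩ P hP
    rw [le_div_iff₀ (by positivity)]
    constructor
    · intro h
      have := h PC
      rw [hD lam P hP, hC lam PC hPC] at this
      linarith
    · intro h Q
      rw [hD lam P hP, hE₄]
      obtain ⟨hc, hcd⟩ := six_le_and_twelve_le (card_cutSet (by norm_num) Q)
      set c : ℝ := ((∑ i ∈ cutSet Q, edgeWeight i : ℕ) : ℝ)
      set d : ℝ := Real.sqrt (sqDev 2 (cutSet Q))
      have hd : 0 ≤ d := Real.sqrt_nonneg _
      have h' : lam * Real.sqrt 6 ≤ 1 - lam := by nlinarith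
      nlinarith [mul_le_mul_of_nonneg_right h' hd, mul_le_mul_of_nonneg_left hcd h0]
  · rintro lam ⟨h0, h1⟩ P hP
    rw [div_le_iff₀ (by positivity)]
    constructor
    · intro h
      have := h PD
      rw [hC lam P hP, hD lam PD hPD] at this
      linarith
    · intro h Q
      rw [hC lam P hP, hE₄]
      obtain ⟨hc, hcd⟩ := six_le_and_twelve_le (card_cutSet (by norm_num) Q)
      set c : ℝ := ((∑ i ∈ cutSet Q, edgeWeight i : ℕ) : ℝ)
      set d : ℝ := Real.sqrt (sqDev 2 (cutSet Q))
      have h' : 1 - lam ≤ lam * Real.sqrt 6 := by nlinarith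
      have hcd' : Real.sqrt 6 * (Real.sqrt 6 - d) ≤ c - 6 := by linarith
      nlinarith [mul_le_mul_of_nonneg_left hcd' (sub_nonneg.2 h1),
        mul_le_mul_of_nonneg_right h' (sub_nonneg.2 hc)]
  · rintro lam h0 h1 Q hQ P hP ⟨φ, hφ, hφ2⟩
    have hrange := (ha lam h0 h1 P).1 hP
    have hsep : ∀ i : Fin 8, i = 3 ∨ i = 7 → i ∈ cutSet Q := by
      refine fun i hi => mem_cutSet.2 fun k ⟨hk, hk'⟩ => ?_
      have hmem : P.part (φ k) ∈ rangeBT := hrange ▸ Set.mem_range_self _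
      have hk := hφ k hk
      have hk' := hφ k hk'
      rcases hi with rfl | rfl <;> rcases hmem with h | h <;> rw [h] at hk hk' <;>
        revert hk hk' <;> decide
    have hcount : ∀ S ∈ rangeBT, 2 ≤ (cutSet Q ∩ S).card := by
      intro S hS
      obtain ⟨m, rfl⟩ : ∃ m, P.part m = S := by rwa [← hrange] at hS
      obtain ⟨ι, hι, himg, hpart⟩ := exists_arc (by norm_num) Q
      refine ((hφ2 m).symm.trans (card_image_of_injective _ hι).symm).le.trans
        (card_le_card fun i hi => ?_)
      obtain ⟨k, hk, rfl⟩ := mem_image.1 hi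
      refine mem_inter.2 ⟨himg ▸ mem_image_of_mem ι (mem_univ k), ?_⟩
      rw [← (mem_filter.1 hk).2]
      refine hφ k ?_
      rw [hpart]
      simp [arc]
    have hleD := hQ PD
    have hleC := hQ PC
    rw [hD lam PD hPD, hE₄] at hleD
    rw [hC lam PC hPC, hE₄] at hleC
    rcases cost_bounds_of_separated _ (card_cutSet (by norm_num) Q) (hsep 3 (Or.inl rfl))
      (hsep 7 (Or.inr rfl)) (hcount _ (Or.inl rfl)) (hcount _ (Or.inr rfl)) with ⟨hc, -⟩ | ⟨hc, hd⟩
    · have hc' : (14 : ℝ) ≤ (∑ i ∈ cutSet Q, edgeWeight i : ℕ) := by exact_mod_cast hc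
      nlinarith [mul_nonneg (sub_nonneg.2 h1.le) (Real.sqrt_nonneg (sqDev 2 (cutSet Q)))]
    · have hc' : (8 : ℝ) ≤ (∑ i ∈ cutSet Q, edgeWeight i : ℕ) := by exact_mod_cast hc
      have hd' := le_sqrt_of_le_intCast (a := 2) (m := 4) hd (by norm_num)
      have hs' : Real.sqrt 6 ≤ 5 / 2 := Real.sqrt_le_iff.2 (by norm_num)
      have h₁ := mul_le_mul_of_nonneg_left hc' h0.le
      have h₂ := mul_le_mul_of_nonneg_left hd' (sub_nonneg.2 h1.le)
      have h₃ := mul_le_mul_of_nonneg_left hs' (sub_nonneg.2 h1.le)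
      linarith

end Districting
end
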